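/- arXiv:2407.04282 — 2 statements merged into one kernel-verified Lean document; each statement's English description precedes it below -/
import Mathlib

section
/- Let T be a finite tree with integer vertex weights w(v) ≥ 1 for every vertex v, and let n be the total weight of all vertices of T. Let g ≥ 1 be an integer and let S and Z be two distinct vertices of T. Suppose that every vertex lying strictly between S and Z on the unique path from S to Z in T has weight at least g, and that the total weight of the connected component of T − S containing Z is at most n/2. Then the distance dist_T(S,Z) (the number of edges of the S–Z path) is at most ⌊(n−2)/(2g)⌋ + 1. -/
/- Tree-distance bound (tree-theoretic content of Observation 5 of the paper).
`T` is a finite tree with integer weights `w v ≥ 1`, `n` is the total weight, `g ≥ 1`.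
If every vertex strictly between `S` and `Z` on the unique `S`–`Z` path has weight at
least `g`, and the component of `T − S` containing `Z` has total weight at most `n/2`,
then `dist_T(S,Z) ≤ ⌊(n−2)/(2g)⌋ + 1`. -/
open scoped Classical in
theorem tree_dist_le_of_heavy_path {V : Type*} [Fintype V] (T : SimpleGraph V)
    (hT : T.IsTree) (w : V → ℤ) (hw : ∀ v, 1 ≤ w v) (n : ℤ) (hn : n = ∑ v : V, w v)
    (g : ℤ) (hg : 1 ≤ g) (S Z : V) (hSZ : S ≠ Z)
    (hpath : ∀ p : T.Walk S Z, p.IsPath → ∀ v ∈ p.support, v ≠ S → v ≠ Z → g ≤ w v)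
    (hcomp : ((∑ u ∈ Finset.univ.filter (fun u : V => ∃ hu : u ≠ S,
          (T.induce {v : V | v ≠ S}).Reachable ⟨u, hu⟩ ⟨Z, hSZ.symm⟩), w u : ℤ) : ℚ)
        ≤ (n : ℚ) / 2) :
    (T.dist S Z : ℤ) ≤ ⌊((n : ℚ) - 2) / (2 * g)⌋ + 1 := by
  obtain ⟨p, hp, hlen⟩ := hT.connected.exists_path_of_dist S Z
  have hP := hpath p hp
  rw [← hlen]
  clear hpath hlen
  cases p with
  | nil => exact absurd rfl hSZ
  | @cons _ x _ h q =>
    rw [SimpleGraph.Walk.cons_isPath_iff] at hp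
    obtain ⟨hq, hS⟩ := hp
    have hsub : q.support.toFinset ⊆ Finset.univ.filter (fun u : V => ∃ hu : u ≠ S,
          (T.induce {v : V | v ≠ S}).Reachable ⟨u, hu⟩ ⟨Z, hSZ.symm⟩) := by
      intro u hu
      rw [List.mem_toFinset] at hu
      rw [Finset.mem_filter]
      refine ⟨Finset.mem_univ _, fun e => hS (e ▸ hu), ?_⟩
      have hall : ∀ v ∈ (q.dropUntil u hu).support, v ∈ {v : V | v ≠ S} := by
        intro v hv e
        exact hS (e ▸ q.support_dropUntil_subset hu hv)
      exact ⟨(q.dropUntil u hu).induce _ hall⟩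
    have h1 := Finset.sum_le_sum_of_subset_of_nonneg (f := w) hsub
      (fun i _ _ => by linarith [hw i])
    have hZ : Z ∈ q.support.toFinset := by simp
    rw [← Finset.add_sum_erase _ _ hZ] at h1
    have h2 : (q.support.toFinset.erase Z).card • g ≤ ∑ u ∈ q.support.toFinset.erase Z, w u := by
      apply Finset.card_nsmul_le_sum
      intro u hu
      rw [Finset.mem_erase, List.mem_toFinset] at hu
      exact hP u (by simp [hu.2]) (fun e => hS (e ▸ hu.2)) hu.1
    have hcard : (q.support.toFinset.erase Z).card = q.length := by
      rw [Finset.card_erase_of_mem hZ, List.toFinset_card_of_nodup hq.support_nodup,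
        SimpleGraph.Walk.length_support]
      rfl
    rw [hcard, nsmul_eq_mul] at h2
    have h3 : (q.length : ℤ) * g + 1 ≤ ∑ u ∈ Finset.univ.filter (fun u : V => ∃ hu : u ≠ S,
          (T.induce {v : V | v ≠ S}).Reachable ⟨u, hu⟩ ⟨Z, hSZ.symm⟩), w u := by
      linarith [hw Z]
    have h4 : ((q.length : ℚ) * g + 1) ≤ n / 2 := le_trans (by exact_mod_cast h3) hcomp
    have hg' : (0 : ℚ) < 2 * g := by
      have : (1 : ℚ) ≤ g := by exact_mod_cast hg
      linarith
    have h5 : (q.length : ℤ) ≤ ⌊((n : ℚ) - 2) / (2 * g)⌋ := by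
      rw [Int.le_floor, le_div_iff₀ hg']
      push_cast
      linarith
    rw [SimpleGraph.Walk.length_cons]
    push_cast
    linarith
end

section
/- Let n, g, a be integers with g ≥ 1 and a ≥ 0. Then ⌈(n−a)/(2g)⌉ − 1 ≤ (⌊(n−2)/(2g)⌋ + 1) − 2⌈√a⌉ + 2g + 1, where the divisions are exact rational divisions, √a denotes the real square root of a, and ⌈·⌉ and ⌊·⌋ denote the ceiling and floor functions. -/
/- Arithmetic inequality (Observation 8 of the paper): with `δ = ⌊(n−2)/(2g)⌋ + 1` and
`θ = ⌈(n−a)/(2g)⌉ − 1`, one has `θ ≤ δ − 2⌈√a⌉ + 2g + 1`. -/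
theorem theta_le_delta (n g a : ℤ) (hg : 1 ≤ g) (ha : 0 ≤ a) :
    ⌈((n : ℝ) - (a : ℝ)) / (2 * (g : ℝ))⌉ - 1 ≤
      (⌊((n : ℝ) - 2) / (2 * (g : ℝ))⌋ + 1) - 2 * ⌈Real.sqrt (a : ℝ)⌉ + 2 * g + 1 := by
  have hgR : (0 : ℝ) < 2 * (g : ℝ) := by
    have : (1 : ℝ) ≤ g := by exact_mod_cast hg
    linarith
  have hF := Int.lt_floor_add_one (((n : ℝ) - 2) / (2 * (g : ℝ)))
  have hs := Int.ceil_lt_add_one (Real.sqrt (a : ℝ))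
  have hs0 : 0 ≤ ⌈Real.sqrt (a : ℝ)⌉ := Int.ceil_nonneg (Real.sqrt_nonneg _)
  have haR : (0 : ℝ) ≤ a := by exact_mod_cast ha
  have hsq := Real.sq_sqrt haR
  have hnn := Real.sqrt_nonneg (a : ℝ)
  generalize ⌊((n : ℝ) - 2) / (2 * (g : ℝ))⌋ = F at *
  generalize ⌈Real.sqrt (a : ℝ)⌉ = s at *
  rw [div_lt_iff₀ hgR] at hF
  have hF' : n - 2 < (F + 1) * (2 * g) := by exact_mod_cast hF
  have key : 0 ≤ a + 4 * g ^ 2 + 4 * g - 1 - 4 * g * s := by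
    rcases hs0.eq_or_lt with h | h
    · subst h
      nlinarith
    · have h1 : (1 : ℝ) ≤ s := by exact_mod_cast h
      have h2 : ((s : ℝ) - 1) ^ 2 < a := by nlinarith
      have h3 : (s - 1) ^ 2 < a := by exact_mod_cast h2
      nlinarith [sq_nonneg (s - 1 - 2 * g)]
  have goal' : ⌈((n : ℝ) - (a : ℝ)) / (2 * (g : ℝ))⌉ ≤ F + 3 - 2 * s + 2 * g := by
    rw [Int.ceil_le, div_le_iff₀ hgR]
    have : n - a ≤ (F + 3 - 2 * s + 2 * g) * (2 * g) := by nlinarith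
    exact_mod_cast this
  linarith
end
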